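/- For every natural number k ≥ 1 let P_k = ∏_{j=1}^{k} ( j! · ((j−1)!)² / (k+j−1)! ). Then lim_{k→∞} (1/k²) · log P_k = −log 4. -/

import Mathlib

open Filter Real Finset Nat

/-- The product `P_k`, re-indexed over `range k`. -/
noncomputable def factorialProd (k : ℕ) : ℝ :=
  ∏ i ∈ range k, (((i + 1)! : ℝ) * (i ! : ℝ) ^ 2 / ((k + i)! : ℝ))

theorem prod_Icc_eq_factorialProd (k : ℕ) :
    ∏ j ∈ Finset.Icc 1 k, ((j ! : ℝ) * ((j - 1)! : ℝ) ^ 2 / ((k + j - 1)! : ℝ)) =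
      factorialProd k := by
  rw [← Finset.Ico_add_one_right_eq_Icc, Finset.prod_Ico_eq_prod_range, factorialProd]
  refine Finset.prod_congr (by simp) fun i _ => ?_
  rw [show 1 + i - 1 = i by lia, show k + (1 + i) - 1 = k + i by lia, add_comm 1 i]

theorem factorialProd_pos (k : ℕ) : 0 < factorialProd k :=
  Finset.prod_pos fun _ _ => by positivity

/-- Shifting the window of the product of factorials by one. -/
theorem prod_factorial_window_succ (k : ℕ) :
    (∏ i ∈ range (k + 1), ((k + 1 + i)! : ℝ)) * (k ! : ℝ) =
      (∏ i ∈ range k, ((k + i)! : ℝ)) * ((2 * k)! : ℝ) * ((2 * k + 1)! : ℝ) := by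
  have h := Finset.prod_range_succ' (fun i => ((k + i)! : ℝ)) (k + 1)
  rw [Finset.prod_range_succ, Finset.prod_range_succ] at h
  simp only [add_zero, ← two_mul, ← add_assoc] at h
  rw [h]
  simp only [add_right_comm]

theorem factorialProd_succ (k : ℕ) :
    factorialProd (k + 1) =
      factorialProd k * (((k : ℝ) + 1) / ((2 * k + 1) * (k.centralBinom : ℝ) ^ 2)) := by
  have hw := prod_factorial_window_succ k
  have hc : ((2 * k)! : ℝ) = k.centralBinom * (k ! : ℝ) ^ 2 := by
    have := Nat.choose_mul_factorial_mul_factorial (n := 2 * k) (k := k) (by lia)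
    rw [show 2 * k - k = k by lia, ← Nat.centralBinom_eq_two_mul_choose] at this
    rw [← this]; push_cast; ring
  have hs : ((2 * k + 1)! : ℝ) = (2 * k + 1) * (2 * k)! := by
    rw [Nat.factorial_succ]; push_cast; ring
  have hk : ((k + 1)! : ℝ) = (k + 1) * k ! := by
    rw [Nat.factorial_succ]; push_cast; ring
  have hD : (∏ i ∈ range k, ((k + i)! : ℝ)) ≠ 0 :=
    Finset.prod_ne_zero_iff.2 fun _ _ => by positivity
  have hf : (k ! : ℝ) ≠ 0 := by positivity
  have hb : (k.centralBinom : ℝ) ≠ 0 := by exact_mod_cast k.centralBinom_ne_zero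
  have h2 : (2 * k + 1 : ℝ) ≠ 0 := by positivity
  rw [hs, hc] at hw
  have hw' : (∏ i ∈ range (k + 1), ((k + 1 + i)! : ℝ)) =
      (∏ i ∈ range k, ((k + i)! : ℝ)) * (k.centralBinom ^ 2 * (k ! : ℝ) ^ 3 * (2 * k + 1)) := by
    apply mul_right_cancel₀ hf
    rw [hw]; ring
  unfold factorialProd
  rw [Finset.prod_div_distrib, Finset.prod_div_distrib, hw', Finset.prod_range_succ, hk]
  field_simp

theorem log_factorialProd_succ (k : ℕ) :
    Real.log (factorialProd (k + 1)) = Real.log (factorialProd k) +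
      (Real.log (k + 1) - Real.log (2 * k + 1) - 2 * Real.log k.centralBinom) := by
  have hb : (k.centralBinom : ℝ) ≠ 0 := by exact_mod_cast k.centralBinom_ne_zero
  rw [factorialProd_succ, Real.log_mul (factorialProd_pos k).ne' (by positivity),
    Real.log_div (by positivity) (by positivity), Real.log_mul (by positivity) (by positivity),
    Real.log_pow]
  push_cast; ring

theorem log_centralBinom_le (k : ℕ) : Real.log k.centralBinom ≤ k * Real.log 4 := by
  have hb : (0 : ℝ) < k.centralBinom := by exact_mod_cast k.centralBinom_pos
  rw [← Real.log_pow]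
  apply Real.log_le_log hb
  have : k.centralBinom ≤ 4 ^ k := by
    rw [Nat.centralBinom_eq_two_mul_choose, show 4 = 2 ^ 2 by rfl, ← pow_mul]
    exact Nat.choose_le_two_pow _ _
  exact_mod_cast this

theorem le_log_centralBinom (k : ℕ) :
    k * Real.log 4 - Real.log (2 * (k + 1)) ≤ Real.log k.centralBinom := by
  have hb : (0 : ℝ) < k.centralBinom := by exact_mod_cast k.centralBinom_pos
  rw [sub_le_iff_le_add', ← Real.log_pow, ← Real.log_mul (by positivity) hb.ne']
  apply Real.log_le_log (by positivity)
  have : 4 ^ k ≤ 2 * (k + 1) * k.centralBinom := by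
    rcases Nat.eq_zero_or_pos k with rfl | hk
    · simp
    · exact (Nat.four_pow_le_two_mul_self_mul_centralBinom k hk).trans (by gcongr; lia)
  exact_mod_cast this

theorem le_log_factorialProd (k : ℕ) :
    -(k * (k - 1) * Real.log 4) - k * Real.log 2 ≤ Real.log (factorialProd k) := by
  induction k with
  | zero => simp [factorialProd]
  | succ k ih =>
    have h : Real.log (2 * k + 1) ≤ Real.log 2 + Real.log (k + 1) := by
      rw [← Real.log_mul (by positivity) (by positivity)]
      exact Real.log_le_log (by positivity) (by linarith)
    have hc := log_centralBinom_le k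
    rw [log_factorialProd_succ]
    push_cast
    linarith

theorem log_factorialProd_le (k : ℕ) :
    Real.log (factorialProd k) ≤ -(k * (k - 1) * Real.log 4) + 2 * k * Real.log (2 * k) := by
  induction k with
  | zero => simp [factorialProd]
  | succ k ih =>
    have h : Real.log (k + 1) ≤ Real.log (2 * k + 1) :=
      Real.log_le_log (by positivity) (by linarith [k.cast_nonneg (α := ℝ)])
    have hm : (k : ℝ) * Real.log (2 * k) ≤ k * Real.log (2 * (k + 1)) := by
      rcases Nat.eq_zero_or_pos k with rfl | hk
      · simp
      · gcongr; linarith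
    have hc := le_log_centralBinom k
    rw [log_factorialProd_succ]
    push_cast
    linarith

theorem tendsto_log_two_mul_div_atTop :
    Tendsto (fun k : ℕ => Real.log (2 * k) / (k : ℝ)) atTop (nhds 0) := by
  have h := (Real.isLittleO_log_id_atTop.tendsto_div_nhds_zero.comp
    (tendsto_natCast_atTop_atTop.const_mul_atTop (two_pos (α := ℝ)))).const_mul 2
  rw [mul_zero] at h
  refine h.congr fun k => ?_
  simp only [Function.comp_apply, id]
  rw [mul_div_assoc', mul_div_mul_left _ _ two_ne_zero]

/-- For every `k ≥ 1` let `P_k = ∏_{j=1}^{k} j! ((j-1)!)² / (k+j-1)!`.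
Then `(1/k²) log P_k → - log 4` as `k → ∞`. -/
theorem stmt0 :
    Tendsto (fun k : ℕ =>
        (1 / (k : ℝ) ^ 2) *
          Real.log (∏ j ∈ Finset.Icc 1 k,
            ((j ! : ℝ) * ((j - 1)! : ℝ) ^ 2 / ((k + j - 1)! : ℝ))))
      atTop (nhds (-Real.log 4)) := by
  simp only [prod_Icc_eq_factorialProd]
  have hlow : Tendsto (fun k : ℕ => -Real.log 4 + (Real.log 4 - Real.log 2) / (k : ℝ))
      atTop (nhds (-Real.log 4)) := by
    simpa using (tendsto_const_div_atTop_nhds_zero_nat (Real.log 4 - Real.log 2)).const_add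
      (-Real.log 4)
  have hupp : Tendsto (fun k : ℕ => -Real.log 4 + Real.log 4 / (k : ℝ) +
      2 * (Real.log (2 * k) / (k : ℝ))) atTop (nhds (-Real.log 4)) := by
    simpa using ((tendsto_const_div_atTop_nhds_zero_nat (Real.log 4)).const_add
      (-Real.log 4)).add (tendsto_log_two_mul_div_atTop.const_mul 2)
  refine tendsto_of_tendsto_of_tendsto_of_le_of_le' hlow hupp ?_ ?_
  · filter_upwards [eventually_gt_atTop 0] with k hk
    have hk' : (0 : ℝ) < k := by exact_mod_cast hk
    rw [one_div_mul_eq_div, le_div_iff₀ (by positivity)]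
    refine le_of_eq_of_le ?_ (le_log_factorialProd k)
    field_simp
    ring
  · filter_upwards [eventually_gt_atTop 0] with k hk
    have hk' : (0 : ℝ) < k := by exact_mod_cast hk
    rw [one_div_mul_eq_div, div_le_iff₀ (by positivity)]
    refine (log_factorialProd_le k).trans_eq ?_
    field_simp
    ring
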